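/- arXiv:2010.14322 — 4 statements merged into one kernel-verified Lean document; each statement's English description precedes it below -/
import Mathlib

section
/- (i) For every (s,z) feasible to the convex problem (P) there exists θ ∈ [0,1]^n with z = Forward(s,θ); hence (s,θ) is feasible to the reformulation (R): minimize f(s, Forward(s,θ)) over (s,θ) ∈ S × [0,1]^n, with the same objective value f(s,z). (ii) If for every s ∈ S and θ ∈ [0,1]^n the point z = Forward(s,θ) satisfies μ_i(s, z_{1:i−1}) ≤ η_i(s, z_{1:i−1}) for all i ∈ {1,…,n}, then for every (s,θ) ∈ S × [0,1]^n the pair (s, Forward(s,θ)) is feasible to (P) with the same objective value; consequently the optimal (infimal) values of (P) and (R) coincide. -/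
open Finset

noncomputable section

/-- Euclidean (ℓ2) norm of a finite vector. -/
def en {k : ℕ} (x : Fin k → ℝ) : ℝ := Real.sqrt (∑ i, x i ^ 2)

/-- Spectral norm (ℓ2→ℓ2 operator norm) of a matrix. -/
def specNorm {k l : ℕ} (M : Fin k → Fin l → ℝ) : ℝ :=
  sSup {v | ∃ x : Fin l → ℝ, (∑ j, x j ^ 2) ≤ 1 ∧ v = en (fun i => ∑ j, M i j * x j)}

/-- Partial derivative of `g` in the `j`-th coordinate at `x`. -/
def pd {k : ℕ} (g : (Fin k → ℝ) → ℝ) (x : Fin k → ℝ) (j : Fin k) : ℝ :=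
  deriv (fun t => g (Function.update x j t)) (x j)

/-- Euclidean diameter of a set of vectors. -/
def ediam {k : ℕ} (S : Set (Fin k → ℝ)) : ℝ :=
  sSup {v | ∃ a ∈ S, ∃ b ∈ S, v = en (fun j => a j - b j)}

variable {m n : ℕ}

/-- Forward completion: coordinates `< k` are read from `w`, later ones are computed via
`z_j = (1-θ_j) μ_j(s,z) + θ_j η_j(s,z)`. -/
def fwdFrom (μ η : Fin n → (Fin m → ℝ) → (Fin n → ℝ) → ℝ) (s : Fin m → ℝ)
    (θ : Fin n → ℝ) (k : ℕ) (w : Fin n → ℝ) : Fin n → ℝ :=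
  fun j => Nat.strongRecOn (motive := fun _ => ℝ) j.val (fun j ih =>
    if hj : j < n then
      if j < k then w ⟨j, hj⟩
      else
        (1 - θ ⟨j, hj⟩) * μ ⟨j, hj⟩ s (fun l => if h : (l : ℕ) < j then ih l.val h else 0)
          + θ ⟨j, hj⟩ * η ⟨j, hj⟩ s (fun l => if h : (l : ℕ) < j then ih l.val h else 0)
    else 0)

/-- `Forward(s,θ)`. -/
def Fwd (μ η : Fin n → (Fin m → ℝ) → (Fin n → ℝ) → ℝ) (s : Fin m → ℝ)
    (θ : Fin n → ℝ) : Fin n → ℝ :=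
  fwdFrom μ η s θ 0 0

/-- `ψ₀(s,θ) = f(s, Forward(s,θ))`. -/
def psi0 (f : (Fin m → ℝ) → (Fin n → ℝ) → ℝ)
    (μ η : Fin n → (Fin m → ℝ) → (Fin n → ℝ) → ℝ) (s : Fin m → ℝ) (θ : Fin n → ℝ) : ℝ :=
  f s (Fwd μ η s θ)

/-- `y_i = ∂ψ_i(s, z_{1:i}, θ_{i+1:n})/∂z_i` at `z = Forward(s,θ)`. -/
def psiD (f : (Fin m → ℝ) → (Fin n → ℝ) → ℝ)
    (μ η : Fin n → (Fin m → ℝ) → (Fin n → ℝ) → ℝ) (s : Fin m → ℝ) (θ : Fin n → ℝ) :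
    Fin n → ℝ :=
  fun i => deriv
    (fun t : ℝ => f s (fwdFrom μ η s θ ((i : ℕ) + 1) (Function.update (Fwd μ η s θ) i t)))
    (Fwd μ η s θ i)

/-- Gradient of `ψ₀` with respect to the `s` argument. -/
def gradSpsi0 (f : (Fin m → ℝ) → (Fin n → ℝ) → ℝ)
    (μ η : Fin n → (Fin m → ℝ) → (Fin n → ℝ) → ℝ) (s : Fin m → ℝ) (θ : Fin n → ℝ) :
    Fin m → ℝ :=
  fun j => pd (fun s' => psi0 f μ η s' θ) s j

/-- Gradient of `ψ₀` with respect to the `θ` argument. -/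
def gradTpsi0 (f : (Fin m → ℝ) → (Fin n → ℝ) → ℝ)
    (μ η : Fin n → (Fin m → ℝ) → (Fin n → ℝ) → ℝ) (s : Fin m → ℝ) (θ : Fin n → ℝ) :
    Fin n → ℝ :=
  fun i => pd (fun θ' => psi0 f μ η s θ') θ i

/-- `δ_L(s,θ)`: minus the optimal value of the projected-gradient step subproblem. -/
def deltaL (f : (Fin m → ℝ) → (Fin n → ℝ) → ℝ)
    (μ η : Fin n → (Fin m → ℝ) → (Fin n → ℝ) → ℝ) (S : Set (Fin m → ℝ)) (L : ℝ)
    (s : Fin m → ℝ) (θ : Fin n → ℝ) : ℝ :=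
  - sInf {v | ∃ ds : Fin m → ℝ, ∃ dθ : Fin n → ℝ, s + ds ∈ S ∧
      (∀ i, θ i + dθ i ∈ Set.Icc (0:ℝ) 1) ∧
      v = (∑ j, gradSpsi0 f μ η s θ j * ds j) + (∑ i, gradTpsi0 f μ η s θ i * dθ i)
          + L / 2 * ((∑ j, ds j ^ 2) + ∑ i, dθ i ^ 2)}

/-- The degeneracy index set `𝒦_γ(s,θ)`. -/
def Kset (f : (Fin m → ℝ) → (Fin n → ℝ) → ℝ)
    (μ η : Fin n → (Fin m → ℝ) → (Fin n → ℝ) → ℝ) (γ : ℝ) (s : Fin m → ℝ)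
    (θ : Fin n → ℝ) : Set (Fin n) :=
  {i | η i s (Fwd μ η s θ) - μ i s (Fwd μ η s θ) ≤ γ ∧
       0 < θ i * max (psiD f μ η s θ i) 0 + (1 - θ i) * max (-(psiD f μ η s θ i)) 0}

/-- The Lagrangian `𝓛(s,z,y)`. -/
def Lag (f : (Fin m → ℝ) → (Fin n → ℝ) → ℝ)
    (μ η : Fin n → (Fin m → ℝ) → (Fin n → ℝ) → ℝ) (s : Fin m → ℝ) (z y : Fin n → ℝ) : ℝ :=
  f s z + ∑ i, (max (y i) 0 * μ i s z - max (-(y i)) 0 * η i s z - y i * z i)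

/-- Gradient of the Lagrangian in the `s` argument. -/
def gradSLag (f : (Fin m → ℝ) → (Fin n → ℝ) → ℝ)
    (μ η : Fin n → (Fin m → ℝ) → (Fin n → ℝ) → ℝ) (s : Fin m → ℝ) (z y : Fin n → ℝ) :
    Fin m → ℝ :=
  fun j => pd (fun s' => Lag f μ η s' z y) s j

/-- Gradient of the Lagrangian in the `z` argument. -/
def gradZLag (f : (Fin m → ℝ) → (Fin n → ℝ) → ℝ)
    (μ η : Fin n → (Fin m → ℝ) → (Fin n → ℝ) → ℝ) (s : Fin m → ℝ) (z y : Fin n → ℝ) :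
    Fin n → ℝ :=
  fun j => pd (fun z' => Lag f μ η s z' y) z j

/-- The duality-gap estimate `Δ(s,θ)`. -/
def Delta (f : (Fin m → ℝ) → (Fin n → ℝ) → ℝ)
    (μ η : Fin n → (Fin m → ℝ) → (Fin n → ℝ) → ℝ) (S : Set (Fin m → ℝ))
    (Z : Set (Fin n → ℝ)) (s : Fin m → ℝ) (θ : Fin n → ℝ) : ℝ :=
  (∑ i, (psiD f μ η s θ i * Fwd μ η s θ i
      - max (psiD f μ η s θ i) 0 * μ i s (Fwd μ η s θ)
      + max (-(psiD f μ η s θ i)) 0 * η i s (Fwd μ η s θ)))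
  + sSup {v | ∃ sh ∈ S, ∃ zh ∈ Z,
      v = (∑ j, gradSLag f μ η s (Fwd μ η s θ) (psiD f μ η s θ) j * (sh j - s j))
        + ∑ i, gradZLag f μ η s (Fwd μ η s θ) (psiD f μ η s θ) i * (zh i - Fwd μ η s θ i)}

/-- Feasibility for the convex problem (P). -/
def Feas (μ η : Fin n → (Fin m → ℝ) → (Fin n → ℝ) → ℝ) (S : Set (Fin m → ℝ))
    (s : Fin m → ℝ) (z : Fin n → ℝ) : Prop :=
  s ∈ S ∧ ∀ i, μ i s z ≤ z i ∧ z i ≤ η i s z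

/-- The recursion defining `Fwd`: each coordinate interpolates between its bounds. -/
lemma Fwd_apply (μ η : Fin n → (Fin m → ℝ) → (Fin n → ℝ) → ℝ)
    (hμdep : ∀ (i : Fin n) (s : Fin m → ℝ) (z z' : Fin n → ℝ),
      (∀ j, j < i → z j = z' j) → μ i s z = μ i s z')
    (hηdep : ∀ (i : Fin n) (s : Fin m → ℝ) (z z' : Fin n → ℝ),
      (∀ j, j < i → z j = z' j) → η i s z = η i s z')
    (s : Fin m → ℝ) (θ : Fin n → ℝ) (i : Fin n) :
    Fwd μ η s θ i = (1 - θ i) * μ i s (Fwd μ η s θ) + θ i * η i s (Fwd μ η s θ) := by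
  have htrunc : ∀ j, j < i →
      (if (j : ℕ) < i then Fwd μ η s θ j else 0) = Fwd μ η s θ j :=
    fun j hj => if_pos hj
  rw [← hμdep i s _ _ htrunc, ← hηdep i s _ _ htrunc]
  conv_lhs => rw [Fwd, fwdFrom, Nat.strongRecOn_eq]
  simp only [i.isLt, Nat.not_lt_zero, if_false, Fin.eta, dite_eq_ite]
  rfl

/-- `Fwd` is the only solution of its recursion. -/
lemma eq_Fwd_of_forall_apply (μ η : Fin n → (Fin m → ℝ) → (Fin n → ℝ) → ℝ)
    (hμdep : ∀ (i : Fin n) (s : Fin m → ℝ) (z z' : Fin n → ℝ),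
      (∀ j, j < i → z j = z' j) → μ i s z = μ i s z')
    (hηdep : ∀ (i : Fin n) (s : Fin m → ℝ) (z z' : Fin n → ℝ),
      (∀ j, j < i → z j = z' j) → η i s z = η i s z')
    {s : Fin m → ℝ} {θ z : Fin n → ℝ}
    (hz : ∀ i, z i = (1 - θ i) * μ i s z + θ i * η i s z) :
    z = Fwd μ η s θ := by
  funext i
  induction i using WellFoundedLT.induction with
  | ind i ih =>
    rw [hz i, Fwd_apply μ η hμdep hηdep, hμdep i s _ _ ih, hηdep i s _ _ ih]

/-- Every point of a real interval is a convex combination of its endpoints. -/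
lemma exists_mem_Icc_eq_combo {a b x : ℝ} (ha : a ≤ x) (hb : x ≤ b) :
    ∃ t ∈ Set.Icc (0 : ℝ) 1, x = (1 - t) * a + t * b := by
  have hx : x ∈ segment ℝ a b := by
    rw [segment_eq_Icc (ha.trans hb)]
    exact ⟨ha, hb⟩
  rw [segment_eq_image] at hx
  obtain ⟨t, ht, rfl⟩ := hx
  exact ⟨t, ht, rfl⟩

/-- Every point satisfying the bounds is a forward completion. -/
lemma Feas.exists_eq_Fwd {μ η : Fin n → (Fin m → ℝ) → (Fin n → ℝ) → ℝ}
    (hμdep : ∀ (i : Fin n) (s : Fin m → ℝ) (z z' : Fin n → ℝ),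
      (∀ j, j < i → z j = z' j) → μ i s z = μ i s z')
    (hηdep : ∀ (i : Fin n) (s : Fin m → ℝ) (z z' : Fin n → ℝ),
      (∀ j, j < i → z j = z' j) → η i s z = η i s z')
    {S : Set (Fin m → ℝ)} {s : Fin m → ℝ} {z : Fin n → ℝ} (h : Feas μ η S s z) :
    ∃ θ : Fin n → ℝ, (∀ i, θ i ∈ Set.Icc (0 : ℝ) 1) ∧ z = Fwd μ η s θ := by
  choose θ hθ hz using fun i => exists_mem_Icc_eq_combo (h.2 i).1 (h.2 i).2
  exact ⟨θ, hθ, eq_Fwd_of_forall_apply μ η hμdep hηdep hz⟩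

/-- A forward completion whose bounds are consistently ordered is feasible. -/
lemma feas_Fwd {μ η : Fin n → (Fin m → ℝ) → (Fin n → ℝ) → ℝ}
    (hμdep : ∀ (i : Fin n) (s : Fin m → ℝ) (z z' : Fin n → ℝ),
      (∀ j, j < i → z j = z' j) → μ i s z = μ i s z')
    (hηdep : ∀ (i : Fin n) (s : Fin m → ℝ) (z z' : Fin n → ℝ),
      (∀ j, j < i → z j = z' j) → η i s z = η i s z')
    {S : Set (Fin m → ℝ)} {s : Fin m → ℝ} (hs : s ∈ S) {θ : Fin n → ℝ}
    (hθ : ∀ i, θ i ∈ Set.Icc (0 : ℝ) 1)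
    (hle : ∀ i, μ i s (Fwd μ η s θ) ≤ η i s (Fwd μ η s θ)) :
    Feas μ η S s (Fwd μ η s θ) := by
  refine ⟨hs, fun i => ?_⟩
  rw [Fwd_apply μ η hμdep hηdep s θ i]
  obtain ⟨h0, h1⟩ := hθ i
  constructor <;> nlinarith [hle i]

/-- Theorem 1: equivalence of the convex problem (P) and the nonconvex reformulation (R). -/
theorem stmt0
    (m n : ℕ) (hm : 0 < m) (hn : 0 < n)
    (S : Set (Fin m → ℝ)) (hSne : S.Nonempty) (hSconv : Convex ℝ S)
    (hSbdd : Bornology.IsBounded S)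
    (f : (Fin m → ℝ) → (Fin n → ℝ) → ℝ)
    (μ η : Fin n → (Fin m → ℝ) → (Fin n → ℝ) → ℝ)
    (hfC1 : ContDiff ℝ 1 (fun p : (Fin m → ℝ) × (Fin n → ℝ) => f p.1 p.2))
    (hμC1 : ∀ i, ContDiff ℝ 1 (fun p : (Fin m → ℝ) × (Fin n → ℝ) => μ i p.1 p.2))
    (hηC1 : ∀ i, ContDiff ℝ 1 (fun p : (Fin m → ℝ) × (Fin n → ℝ) => η i p.1 p.2))
    (hfconv : ConvexOn ℝ (S ×ˢ (Set.univ : Set (Fin n → ℝ)))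
      (fun p : (Fin m → ℝ) × (Fin n → ℝ) => f p.1 p.2))
    (hμconv : ∀ i, ConvexOn ℝ (S ×ˢ (Set.univ : Set (Fin n → ℝ)))
      (fun p : (Fin m → ℝ) × (Fin n → ℝ) => μ i p.1 p.2))
    (hηconc : ∀ i, ConcaveOn ℝ (S ×ˢ (Set.univ : Set (Fin n → ℝ)))
      (fun p : (Fin m → ℝ) × (Fin n → ℝ) => η i p.1 p.2))
    (hμdep : ∀ (i : Fin n) (s : Fin m → ℝ) (z z' : Fin n → ℝ),
      (∀ j, j < i → z j = z' j) → μ i s z = μ i s z')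
    (hηdep : ∀ (i : Fin n) (s : Fin m → ℝ) (z z' : Fin n → ℝ),
      (∀ j, j < i → z j = z' j) → η i s z = η i s z')
    :
    (∀ (s : Fin m → ℝ) (z : Fin n → ℝ), Feas μ η S s z →
      ∃ θ : Fin n → ℝ, (∀ i, θ i ∈ Set.Icc (0:ℝ) 1) ∧ z = Fwd μ η s θ ∧
        psi0 f μ η s θ = f s z) ∧
    ((∀ s ∈ S, ∀ θ : Fin n → ℝ, (∀ i, θ i ∈ Set.Icc (0:ℝ) 1) →
        ∀ i, μ i s (Fwd μ η s θ) ≤ η i s (Fwd μ η s θ)) →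
      (∀ s ∈ S, ∀ θ : Fin n → ℝ, (∀ i, θ i ∈ Set.Icc (0:ℝ) 1) →
        Feas μ η S s (Fwd μ η s θ)) ∧
      sInf {v | ∃ s z, Feas μ η S s z ∧ v = f s z}
        = sInf {v | ∃ s ∈ S, ∃ θ : Fin n → ℝ,
            (∀ i, θ i ∈ Set.Icc (0:ℝ) 1) ∧ v = psi0 f μ η s θ}) := by
  refine ⟨fun s z hz => ?_, fun hle =>
    ⟨fun s hs θ hθ => feas_Fwd hμdep hηdep hs hθ (hle s hs θ hθ), ?_⟩⟩
  · obtain ⟨θ, hθ, rfl⟩ := hz.exists_eq_Fwd hμdep hηdep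
    exact ⟨θ, hθ, rfl, rfl⟩
  · congr 1
    ext v
    constructor
    · rintro ⟨s, z, hz, rfl⟩
      obtain ⟨θ, hθ, rfl⟩ := hz.exists_eq_Fwd hμdep hηdep
      exact ⟨s, hz.1, θ, hθ, rfl⟩
    · rintro ⟨s, hs, θ, hθ, rfl⟩
      exact ⟨s, _, feas_Fwd hμdep hηdep hs hθ (hle s hs θ hθ), rfl⟩

end
end

section
/- Let (s,θ) ∈ S × [0,1]^n, z = Forward(s,θ), y_i = ∂ψ_i(s, z_{1:i}, θ_{i+1:n})/∂z_i, and r_i = θ_i y_i⁺ + (1−θ_i) y_i⁻. Then ‖∇_s 𝓛(s,z,y) − ∇_s ψ_0(s,θ)‖_2 ≤ ‖∇_s μ − ∇_s η‖_2 · ‖r‖_2, where ∇_s μ − ∇_s η is the n × m matrix whose i-th row is ∇_s μ_i(s, z_{1:i−1}) − ∇_s η_i(s, z_{1:i−1}) and its norm is the spectral norm. -/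
open Finset

noncomputable section

variable {m n : ℕ}

section SpectralNorm

variable {k l : ℕ}

lemma en_nonneg (x : Fin k → ℝ) : 0 ≤ en x := Real.sqrt_nonneg _

lemma en_sq (x : Fin k → ℝ) : en x ^ 2 = ∑ i, x i ^ 2 :=
  Real.sq_sqrt (Finset.sum_nonneg fun _ _ => sq_nonneg _)

lemma sum_mul_le_en_mul_en (x y : Fin k → ℝ) : ∑ i, x i * y i ≤ en x * en y :=
  Real.sum_mul_le_sqrt_mul_sqrt _ _ _

lemma en_smul (c : ℝ) (x : Fin k → ℝ) : en (fun i => c * x i) = |c| * en x := by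
  simp only [en, mul_pow, ← Finset.mul_sum]
  rw [Real.sqrt_mul (sq_nonneg c), Real.sqrt_sq_eq_abs]

lemma bddAbove_specNorm (M : Fin k → Fin l → ℝ) :
    BddAbove {v | ∃ x : Fin l → ℝ, (∑ j, x j ^ 2) ≤ 1 ∧ v = en (fun i => ∑ j, M i j * x j)} := by
  refine ⟨Real.sqrt (∑ i, ∑ j, M i j ^ 2), ?_⟩
  rintro v ⟨x, hx, rfl⟩
  refine Real.sqrt_le_sqrt (Finset.sum_le_sum fun i _ => ?_)
  refine (Finset.sum_mul_sq_le_sq_mul_sq _ _ _).trans ?_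
  exact mul_le_of_le_one_right (Finset.sum_nonneg fun _ _ => sq_nonneg _) hx

lemma en_mulVec_le (M : Fin k → Fin l → ℝ) (x : Fin l → ℝ) :
    en (fun i => ∑ j, M i j * x j) ≤ specNorm M * en x := by
  rcases (en_nonneg x).eq_or_lt with h | h
  · have hx : ∀ j, x j = 0 := fun j => by
      have h0 := en_sq x
      rw [← h, zero_pow two_ne_zero, eq_comm,
        Finset.sum_eq_zero_iff_of_nonneg fun _ _ => sq_nonneg _] at h0
      exact pow_eq_zero_iff two_ne_zero |>.1 (h0 j (Finset.mem_univ j))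
    simp [en, hx]
  · have hmem : en (fun i => ∑ j, M i j * ((en x)⁻¹ * x j)) ≤ specNorm M := by
      refine le_csSup (bddAbove_specNorm M) ⟨fun j => (en x)⁻¹ * x j, ?_, rfl⟩
      rw [← en_sq, en_smul, abs_of_pos (inv_pos.2 h), inv_mul_cancel₀ h.ne', one_pow]
    have hscale : (fun i => ∑ j, M i j * ((en x)⁻¹ * x j))
        = fun i => (en x)⁻¹ * ∑ j, M i j * x j := by
      funext i
      rw [Finset.mul_sum]
      exact Finset.sum_congr rfl fun j _ => by ring
    rw [hscale, en_smul, abs_of_pos (inv_pos.2 h), inv_mul_le_iff₀ h] at hmem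
    linarith

lemma en_vecMul_le (M : Fin k → Fin l → ℝ) (r : Fin k → ℝ) :
    en (fun j => ∑ i, r i * M i j) ≤ specNorm M * en r := by
  set v : Fin l → ℝ := fun j => ∑ i, r i * M i j with hv
  have hsq : en v * en v ≤ specNorm M * en r * en v := by
    calc en v * en v = ∑ i, (∑ j, M i j * v j) * r i := by
          rw [← sq, en_sq]
          simp only [Finset.sum_mul]
          rw [Finset.sum_comm]
          refine Finset.sum_congr rfl fun j _ => ?_
          rw [sq]
          nth_rewrite 1 [hv]
          rw [Finset.sum_mul]
          exact Finset.sum_congr rfl fun i _ => by ring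
      _ ≤ en (fun i => ∑ j, M i j * v j) * en r := sum_mul_le_en_mul_en _ _
      _ ≤ specNorm M * en v * en r := by
          gcongr
          · exact en_nonneg r
          · exact en_mulVec_le M v
      _ = specNorm M * en r * en v := by ring
  rcases (en_nonneg v).eq_or_lt with h | h
  · rw [← h]
    refine mul_nonneg (Real.sSup_nonneg ?_) (en_nonneg r)
    rintro w ⟨x, -, rfl⟩
    exact en_nonneg _
  · exact le_of_mul_le_mul_right hsq h

end SpectralNorm

section Forward

lemma hasDerivAt_coord {g : (Fin m → ℝ) → (Fin n → ℝ) → ℝ}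
    (hg : Differentiable ℝ fun p : (Fin m → ℝ) × (Fin n → ℝ) => g p.1 p.2)
    (s : Fin m → ℝ) (z : Fin n → ℝ) (j : Fin m) :
    HasDerivAt (fun t => g (Function.update s j t) z) (pd (fun s' => g s' z) s j) (s j) :=
  DifferentiableAt.hasDerivAt <| hg.differentiableAt.comp (s j)
    ((hasDerivAt_update s j (s j)).differentiableAt.prodMk (differentiableAt_const z))

variable {μ η : Fin n → (Fin m → ℝ) → (Fin n → ℝ) → ℝ}

lemma fwdFrom_of_lt (s : Fin m → ℝ) (θ : Fin n → ℝ) {k : ℕ} (w : Fin n → ℝ) {j : Fin n}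
    (hj : (j : ℕ) < k) : fwdFrom μ η s θ k w j = w j := by
  unfold fwdFrom
  rw [Nat.strongRecOn_eq]
  simp [hj]

lemma fwdFrom_of_le
    (hμ : ∀ (i : Fin n) (s : Fin m → ℝ) (z z' : Fin n → ℝ),
      (∀ j, j < i → z j = z' j) → μ i s z = μ i s z')
    (hη : ∀ (i : Fin n) (s : Fin m → ℝ) (z z' : Fin n → ℝ),
      (∀ j, j < i → z j = z' j) → η i s z = η i s z')
    (s : Fin m → ℝ) (θ : Fin n → ℝ) {k : ℕ} (w : Fin n → ℝ) {j : Fin n} (hj : k ≤ (j : ℕ)) :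
    fwdFrom μ η s θ k w j = (1 - θ j) * μ j s (fwdFrom μ η s θ k w)
      + θ j * η j s (fwdFrom μ η s θ k w) := by
  conv_lhs => unfold fwdFrom
  rw [Nat.strongRecOn_eq]
  simp only [j.isLt, dite_true, not_lt.2 hj, if_false, Fin.eta]
  congr 2
  · refine hμ j s _ _ fun i hi => ?_
    simp only [Fin.lt_def] at hi
    rw [dif_pos hi]
    rfl
  · refine hη j s _ _ fun i hi => ?_
    simp only [Fin.lt_def] at hi
    rw [dif_pos hi]
    rfl

/-- A vector satisfying the forward recursion from index `k` on is the forward completion. -/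
lemma eq_fwdFrom
    (hμ : ∀ (i : Fin n) (s : Fin m → ℝ) (z z' : Fin n → ℝ),
      (∀ j, j < i → z j = z' j) → μ i s z = μ i s z')
    (hη : ∀ (i : Fin n) (s : Fin m → ℝ) (z z' : Fin n → ℝ),
      (∀ j, j < i → z j = z' j) → η i s z = η i s z')
    (s : Fin m → ℝ) (θ : Fin n → ℝ) {k : ℕ} {v w : Fin n → ℝ}
    (hlt : ∀ j : Fin n, (j : ℕ) < k → v j = w j)
    (hle : ∀ j : Fin n, k ≤ (j : ℕ) → v j = (1 - θ j) * μ j s v + θ j * η j s v) :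
    v = fwdFrom μ η s θ k w := by
  funext j
  induction j using WellFoundedLT.induction with
  | ind j ih =>
    rcases lt_or_ge (j : ℕ) k with hj | hj
    · rw [hlt j hj, fwdFrom_of_lt s θ w hj]
    · rw [hle j hj, fwdFrom_of_le hμ hη s θ w hj, hμ j s _ _ ih, hη j s _ _ ih]

lemma fwdFrom_eq_succ_update
    (hμ : ∀ (i : Fin n) (s : Fin m → ℝ) (z z' : Fin n → ℝ),
      (∀ j, j < i → z j = z' j) → μ i s z = μ i s z')
    (hη : ∀ (i : Fin n) (s : Fin m → ℝ) (z z' : Fin n → ℝ),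
      (∀ j, j < i → z j = z' j) → η i s z = η i s z')
    (s : Fin m → ℝ) (θ : Fin n → ℝ) (k : Fin n) (w : Fin n → ℝ) :
    fwdFrom μ η s θ k w = fwdFrom μ η s θ (k + 1)
      (Function.update w k ((1 - θ k) * μ k s w + θ k * η k s w)) := by
  have hagree : ∀ j : Fin n, j < k → fwdFrom μ η s θ k w j = w j :=
    fun j hj => fwdFrom_of_lt s θ w hj
  refine eq_fwdFrom hμ hη s θ (fun j hj => ?_)
    fun j hj => fwdFrom_of_le hμ hη s θ w (Nat.le_of_succ_le hj)
  rcases (Nat.lt_succ_iff.1 hj).lt_or_eq with h | h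
  · rw [hagree j h, Function.update_of_ne (Fin.ne_of_lt h)]
  · obtain rfl : j = k := Fin.ext h
    rw [fwdFrom_of_le hμ hη s θ w le_rfl, Function.update_self, hμ j s _ _ hagree,
      hη j s _ _ hagree]

lemma fwdFrom_card (s : Fin m → ℝ) (θ w : Fin n → ℝ) : fwdFrom μ η s θ n w = w :=
  funext fun j => fwdFrom_of_lt s θ w j.isLt

lemma fwdFrom_zero
    (hμ : ∀ (i : Fin n) (s : Fin m → ℝ) (z z' : Fin n → ℝ),
      (∀ j, j < i → z j = z' j) → μ i s z = μ i s z')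
    (hη : ∀ (i : Fin n) (s : Fin m → ℝ) (z z' : Fin n → ℝ),
      (∀ j, j < i → z j = z' j) → η i s z = η i s z')
    (s : Fin m → ℝ) (θ w : Fin n → ℝ) : fwdFrom μ η s θ 0 w = Fwd μ η s θ :=
  eq_fwdFrom hμ hη s θ (fun _ hj => absurd hj (Nat.not_lt_zero _))
    fun _ hj => fwdFrom_of_le hμ hη s θ w hj

variable {f : (Fin m → ℝ) → (Fin n → ℝ) → ℝ}

lemma differentiable_comp_fwdFrom
    (hf : Differentiable ℝ fun p : (Fin m → ℝ) × (Fin n → ℝ) => f p.1 p.2)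
    (hμd : ∀ i, Differentiable ℝ fun p : (Fin m → ℝ) × (Fin n → ℝ) => μ i p.1 p.2)
    (hηd : ∀ i, Differentiable ℝ fun p : (Fin m → ℝ) × (Fin n → ℝ) => η i p.1 p.2)
    (hμ : ∀ (i : Fin n) (s : Fin m → ℝ) (z z' : Fin n → ℝ),
      (∀ j, j < i → z j = z' j) → μ i s z = μ i s z')
    (hη : ∀ (i : Fin n) (s : Fin m → ℝ) (z z' : Fin n → ℝ),
      (∀ j, j < i → z j = z' j) → η i s z = η i s z')
    (θ : Fin n → ℝ) {k : ℕ} (hk : k ≤ n) :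
    Differentiable ℝ fun p : (Fin m → ℝ) × (Fin n → ℝ) =>
      f p.1 (fwdFrom μ η p.1 θ k p.2) := by
  induction hk using Nat.decreasingInduction with
  | self => simpa only [fwdFrom_card] using hf
  | of_succ k hk ih =>
    have hstep : (fun p : (Fin m → ℝ) × (Fin n → ℝ) => f p.1 (fwdFrom μ η p.1 θ k p.2))
        = (fun p : (Fin m → ℝ) × (Fin n → ℝ) => f p.1 (fwdFrom μ η p.1 θ (k + 1) p.2)) ∘
          fun p => (p.1, Function.update p.2 ⟨k, hk⟩
            ((1 - θ ⟨k, hk⟩) * μ ⟨k, hk⟩ p.1 p.2 + θ ⟨k, hk⟩ * η ⟨k, hk⟩ p.1 p.2)) := by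
      funext p
      exact congrArg (f p.1) (fwdFrom_eq_succ_update hμ hη p.1 θ ⟨k, hk⟩ p.2)
    rw [hstep]
    refine ih.comp (differentiable_fst.prodMk (differentiable_pi.2 fun i => ?_))
    rcases eq_or_ne i ⟨k, hk⟩ with rfl | hi
    · simpa only [Function.update_self] using
        ((hμd _).const_mul _).fun_add ((hηd _).const_mul _)
    · simp only [Function.update_of_ne hi]
      fun_prop

/-- Chain rule along a curve which moves one coordinate of the first argument and, through it,
one coordinate of the second argument. -/
lemma deriv_comp_update_update {g : (Fin m → ℝ) × (Fin n → ℝ) → ℝ} {s : Fin m → ℝ}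
    {z : Fin n → ℝ} (hg : DifferentiableAt ℝ g (s, z)) (j : Fin m) (k : Fin n)
    {u : ℝ → ℝ} {u' : ℝ} (hu : HasDerivAt u u' (s j)) (huz : u (s j) = z k) :
    deriv (fun t => g (Function.update s j t, Function.update z k (u t))) (s j)
      = deriv (fun t => g (Function.update s j t, z)) (s j)
        + deriv (fun t => g (s, Function.update z k t)) (z k) * u' := by
  have hs := hasDerivAt_update s j (s j)
  have hz := hasDerivAt_update z k (z k)
  have hzu : HasDerivAt (fun t => Function.update z k (u t)) (u' • Pi.single k 1) (s j) :=
    HasDerivAt.scomp (g₁ := Function.update z k) (s j) (by rw [huz]; exact hz) hu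
  have hD := hg.hasFDerivAt
  have h1 := HasFDerivAt.comp_hasDerivAt_of_eq (s j) hD (hs.prodMk hzu) (by simp [huz])
  have h2 := HasFDerivAt.comp_hasDerivAt_of_eq (s j) hD
    (hs.prodMk (hasDerivAt_const (s j) z)) (by simp)
  have h3 := HasFDerivAt.comp_hasDerivAt_of_eq (z k) hD
    ((hasDerivAt_const (z k) s).prodMk hz) (by simp)
  have e1 := h1.deriv
  have e2 := h2.deriv
  have e3 := h3.deriv
  simp only [Function.comp_def] at e1 e2 e3
  rw [e1, e2, e3]
  have hsplit : ((Pi.single j 1 : Fin m → ℝ), u' • (Pi.single k 1 : Fin n → ℝ))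
      = (Pi.single j 1, 0) + u' • ((0 : Fin m → ℝ), (Pi.single k 1 : Fin n → ℝ)) := by simp
  rw [hsplit, map_add, map_smul, smul_eq_mul, mul_comm]

lemma gradSpsi0_eq
    (hf : Differentiable ℝ fun p : (Fin m → ℝ) × (Fin n → ℝ) => f p.1 p.2)
    (hμd : ∀ i, Differentiable ℝ fun p : (Fin m → ℝ) × (Fin n → ℝ) => μ i p.1 p.2)
    (hηd : ∀ i, Differentiable ℝ fun p : (Fin m → ℝ) × (Fin n → ℝ) => η i p.1 p.2)
    (hμ : ∀ (i : Fin n) (s : Fin m → ℝ) (z z' : Fin n → ℝ),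
      (∀ j, j < i → z j = z' j) → μ i s z = μ i s z')
    (hη : ∀ (i : Fin n) (s : Fin m → ℝ) (z z' : Fin n → ℝ),
      (∀ j, j < i → z j = z' j) → η i s z = η i s z')
    (s : Fin m → ℝ) (θ : Fin n → ℝ) (j : Fin m) :
    gradSpsi0 f μ η s θ j = pd (fun s' => f s' (Fwd μ η s θ)) s j
      + ∑ i, psiD f μ η s θ i * ((1 - θ i) * pd (fun s' => μ i s' (Fwd μ η s θ)) s j
          + θ i * pd (fun s' => η i s' (Fwd μ η s θ)) s j) := by
  set z := Fwd μ η s θ with hz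
  set A : ℕ → ℝ := fun k => pd (fun s' => f s' (fwdFrom μ η s' θ k z)) s j with hA
  have hstep : ∀ i : Fin n, A i - A (i + 1) = psiD f μ η s θ i *
      ((1 - θ i) * pd (fun s' => μ i s' z) s j + θ i * pd (fun s' => η i s' z) s j) := by
    intro i
    have hu := ((hasDerivAt_coord (hμd i) s z j).const_mul (1 - θ i)).add
      ((hasDerivAt_coord (hηd i) s z j).const_mul (θ i))
    have huz : (1 - θ i) * μ i s z + θ i * η i s z = z i :=
      (fwdFrom_of_le hμ hη s θ 0 (Nat.zero_le i)).symm
    have h := deriv_comp_update_update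
      (differentiable_comp_fwdFrom hf hμd hηd hμ hη θ i.isLt (s, z)) j i hu
      (by simpa using huz)
    have hAi : A i = deriv (fun t => f (Function.update s j t)
        (fwdFrom μ η (Function.update s j t) θ i z)) (s j) := rfl
    rw [sub_eq_iff_eq_add', hAi]
    simp only [fwdFrom_eq_succ_update hμ hη _ θ i z]
    exact h
  have h0 : gradSpsi0 f μ η s θ j = A 0 := by
    simp only [gradSpsi0, psi0, hA, fwdFrom_zero hμ hη]
  have hlast : A n = pd (fun s' => f s' z) s j := by
    simp only [hA, fwdFrom_card]
  rw [h0, ← hlast, ← Finset.sum_congr rfl fun i _ => hstep i,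
    Fin.sum_univ_eq_sum_range (fun i => A i - A (i + 1)) n, Finset.sum_range_sub']
  ring

lemma gradSLag_eq
    (hf : Differentiable ℝ fun p : (Fin m → ℝ) × (Fin n → ℝ) => f p.1 p.2)
    (hμd : ∀ i, Differentiable ℝ fun p : (Fin m → ℝ) × (Fin n → ℝ) => μ i p.1 p.2)
    (hηd : ∀ i, Differentiable ℝ fun p : (Fin m → ℝ) × (Fin n → ℝ) => η i p.1 p.2)
    (s : Fin m → ℝ) (z y : Fin n → ℝ) (j : Fin m) :
    gradSLag f μ η s z y j = pd (fun s' => f s' z) s j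
      + ∑ i, (max (y i) 0 * pd (fun s' => μ i s' z) s j
        - max (-(y i)) 0 * pd (fun s' => η i s' z) s j) :=
  ((hasDerivAt_coord hf s z j).fun_add (HasDerivAt.fun_sum fun i _ =>
    (((hasDerivAt_coord (hμd i) s z j).const_mul _).sub
      ((hasDerivAt_coord (hηd i) s z j).const_mul _)).sub_const _)).deriv

end Forward

/-- Lemma 7, inequality (20a): bound on ‖∇_s 𝓛 − ∇_s ψ₀‖₂. -/
theorem stmt7
    (m n : ℕ) (hm : 0 < m) (hn : 0 < n)
    (S : Set (Fin m → ℝ)) (hSne : S.Nonempty) (hSconv : Convex ℝ S)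
    (hSbdd : Bornology.IsBounded S)
    (f : (Fin m → ℝ) → (Fin n → ℝ) → ℝ)
    (μ η : Fin n → (Fin m → ℝ) → (Fin n → ℝ) → ℝ)
    (hfC1 : ContDiff ℝ 1 (fun p : (Fin m → ℝ) × (Fin n → ℝ) => f p.1 p.2))
    (hμC1 : ∀ i, ContDiff ℝ 1 (fun p : (Fin m → ℝ) × (Fin n → ℝ) => μ i p.1 p.2))
    (hηC1 : ∀ i, ContDiff ℝ 1 (fun p : (Fin m → ℝ) × (Fin n → ℝ) => η i p.1 p.2))
    (hfconv : ConvexOn ℝ (S ×ˢ (Set.univ : Set (Fin n → ℝ)))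
      (fun p : (Fin m → ℝ) × (Fin n → ℝ) => f p.1 p.2))
    (hμconv : ∀ i, ConvexOn ℝ (S ×ˢ (Set.univ : Set (Fin n → ℝ)))
      (fun p : (Fin m → ℝ) × (Fin n → ℝ) => μ i p.1 p.2))
    (hηconc : ∀ i, ConcaveOn ℝ (S ×ˢ (Set.univ : Set (Fin n → ℝ)))
      (fun p : (Fin m → ℝ) × (Fin n → ℝ) => η i p.1 p.2))
    (hμdep : ∀ (i : Fin n) (s : Fin m → ℝ) (z z' : Fin n → ℝ),
      (∀ j, j < i → z j = z' j) → μ i s z = μ i s z')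
    (hηdep : ∀ (i : Fin n) (s : Fin m → ℝ) (z z' : Fin n → ℝ),
      (∀ j, j < i → z j = z' j) → η i s z = η i s z')
    (s : Fin m → ℝ) (θ : Fin n → ℝ) (hs : s ∈ S) (hθ : ∀ i, θ i ∈ Set.Icc (0:ℝ) 1)
    (z y r : Fin n → ℝ) (hz : z = Fwd μ η s θ) (hy : ∀ i, y i = psiD f μ η s θ i)
    (hr : ∀ i, r i = θ i * max (y i) 0 + (1 - θ i) * max (-(y i)) 0) :
    en (fun j => gradSLag f μ η s z y j - gradSpsi0 f μ η s θ j)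
      ≤ specNorm (fun i j =>
          pd (fun s' => μ i s' z) s j - pd (fun s' => η i s' z) s j) * en r := by
  have hf := hfC1.differentiable one_ne_zero
  have hμd := fun i => (hμC1 i).differentiable one_ne_zero
  have hηd := fun i => (hηC1 i).differentiable one_ne_zero
  obtain rfl : y = psiD f μ η s θ := funext hy
  subst hz
  refine le_of_eq_of_le (congrArg en (funext fun j => ?_)) (en_vecMul_le _ r)
  rw [gradSLag_eq hf hμd hηd, gradSpsi0_eq hf hμd hηd hμdep hηdep, add_sub_add_left_eq_sub,
    ← Finset.sum_sub_distrib]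
  refine Finset.sum_congr rfl fun i _ => ?_
  have hpos : psiD f μ η s θ i = max (psiD f μ η s θ i) 0 - max (-(psiD f μ η s θ i)) 0 := by simp
  rw [hr i]
  generalize max (psiD f μ η s θ i) 0 = p at hpos ⊢
  generalize max (-(psiD f μ η s θ i)) 0 = q at hpos ⊢
  rw [hpos]
  ring

end
end

section
/- Let (s,θ) ∈ S × [0,1]^n, z = Forward(s,θ), L > 0, and let i ∈ {1,…,n} be such that η_i(s,z_{1:i−1}) − μ_i(s,z_{1:i−1}) > 0. Define the per-coordinate gain t_{i,L} := −min over d with θ_i + d ∈ [0,1] of [ (∂ψ_0(s,θ)/∂θ_i) d + (L/2) d² ]. Then, with y_i = ∂ψ_i(s, z_{1:i}, θ_{i+1:n})/∂z_i and r_i = θ_i y_i⁺ + (1−θ_i) y_i⁻, it holds that r_i ≤ max{ √(2 L t_{i,L}), 2 t_{i,L} } / ( η_i(s,z_{1:i−1}) − μ_i(s,z_{1:i−1}) ). -/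
open Finset

noncomputable section

variable {m n : ℕ}

lemma fwdFrom_eq (μ η : Fin n → (Fin m → ℝ) → (Fin n → ℝ) → ℝ)
    (hμdep : ∀ (i : Fin n) (s : Fin m → ℝ) (z z' : Fin n → ℝ),
      (∀ j, j < i → z j = z' j) → μ i s z = μ i s z')
    (hηdep : ∀ (i : Fin n) (s : Fin m → ℝ) (z z' : Fin n → ℝ),
      (∀ j, j < i → z j = z' j) → η i s z = η i s z')
    (s : Fin m → ℝ) (θ : Fin n → ℝ) (k : ℕ) (w : Fin n → ℝ) (j : Fin n) :
    fwdFrom μ η s θ k w j = if (j : ℕ) < k then w j else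
      (1 - θ j) * μ j s (fwdFrom μ η s θ k w) + θ j * η j s (fwdFrom μ η s θ k w) := by
  conv_lhs => unfold fwdFrom
  rw [Nat.strongRecOn_eq, dif_pos j.isLt]
  split_ifs
  · rfl
  · congr 2
    · refine hμdep j s _ _ fun l hl => ?_
      rw [dif_pos (show (l : ℕ) < j from hl)]
      rfl
    · refine hηdep j s _ _ fun l hl => ?_
      rw [dif_pos (show (l : ℕ) < j from hl)]
      rfl

/-- `Forward` after changing `θ_i` is the completion from `z_{1:i-1}` and the new `z_i`. -/
lemma Fwd_update (μ η : Fin n → (Fin m → ℝ) → (Fin n → ℝ) → ℝ)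
    (hμdep : ∀ (i : Fin n) (s : Fin m → ℝ) (z z' : Fin n → ℝ),
      (∀ j, j < i → z j = z' j) → μ i s z = μ i s z')
    (hηdep : ∀ (i : Fin n) (s : Fin m → ℝ) (z z' : Fin n → ℝ),
      (∀ j, j < i → z j = z' j) → η i s z = η i s z')
    (s : Fin m → ℝ) (θ : Fin n → ℝ) (i : Fin n) (t : ℝ) :
    Fwd μ η s (Function.update θ i t) =
      fwdFrom μ η s θ (i + 1) (Function.update (Fwd μ η s θ) i
        ((1 - t) * μ i s (Fwd μ η s θ) + t * η i s (Fwd μ η s θ))) := by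
  have key := fwdFrom_eq μ η hμdep hηdep s
  have below : ∀ j : Fin n, j < i → Fwd μ η s (Function.update θ i t) j = Fwd μ η s θ j := by
    intro j
    induction j using WellFoundedLT.induction with
    | ind j ih =>
      intro hj
      unfold Fwd at ih ⊢
      rw [key, key, if_neg (Nat.not_lt_zero _), if_neg (Nat.not_lt_zero _),
        Function.update_of_ne hj.ne,
        hμdep j s _ _ fun l hl => ih l hl (hl.trans hj),
        hηdep j s _ _ fun l hl => ih l hl (hl.trans hj)]
  funext j
  induction j using WellFoundedLT.induction with
  | ind j ih =>
    rw [key θ]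
    rcases lt_trichotomy j i with hj | rfl | hj
    · rw [if_pos (Nat.lt_succ_of_lt hj), Function.update_of_ne hj.ne, below j hj]
    · rw [if_pos (Nat.lt_succ_self _), Function.update_self, ← hμdep j s _ _ below,
        ← hηdep j s _ _ below]
      unfold Fwd
      conv_lhs => rw [key]
      rw [if_neg (Nat.not_lt_zero _), Function.update_self]
    · have hj' : ¬ (j : ℕ) < i + 1 := not_lt.2 (Nat.succ_le_of_lt hj)
      rw [if_neg hj', ← hμdep j s _ _ ih, ← hηdep j s _ _ ih]
      unfold Fwd
      conv_lhs => rw [key]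
      rw [if_neg (Nat.not_lt_zero _), Function.update_of_ne hj.ne']

lemma differentiable_fwdFrom_update (μ η : Fin n → (Fin m → ℝ) → (Fin n → ℝ) → ℝ)
    (s : Fin m → ℝ) (θ w : Fin n → ℝ)
    (hμC1 : ∀ i, ContDiff ℝ 1 (fun p : (Fin m → ℝ) × (Fin n → ℝ) => μ i p.1 p.2))
    (hηC1 : ∀ i, ContDiff ℝ 1 (fun p : (Fin m → ℝ) × (Fin n → ℝ) => η i p.1 p.2))
    (hμdep : ∀ (i : Fin n) (s : Fin m → ℝ) (z z' : Fin n → ℝ),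
      (∀ j, j < i → z j = z' j) → μ i s z = μ i s z')
    (hηdep : ∀ (i : Fin n) (s : Fin m → ℝ) (z z' : Fin n → ℝ),
      (∀ j, j < i → z j = z' j) → η i s z = η i s z')
    (k : ℕ) (i : Fin n) :
    Differentiable ℝ fun t : ℝ => fwdFrom μ η s θ k (Function.update w i t) := by
  rw [differentiable_pi]
  intro j
  induction j using WellFoundedLT.induction with
  | ind j ih =>
    have key := fun t : ℝ => fwdFrom_eq μ η hμdep hηdep s θ k (Function.update w i t) j
    by_cases hj : (j : ℕ) < k
    · simp only [key, if_pos hj]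
      exact differentiable_pi.1 (contDiff_update 1 w i |>.differentiable one_ne_zero) j
    · let F : ℝ → Fin n → ℝ := fun t l =>
        if l < j then fwdFrom μ η s θ k (Function.update w i t) l else 0
      have hF : Differentiable ℝ F := by
        rw [differentiable_pi]
        intro l
        by_cases hl : l < j
        · simpa only [F, if_pos hl] using ih l hl
        · simp only [F, if_neg hl]
          exact differentiable_const _
      have hFeq : ∀ t l, l < j → fwdFrom μ η s θ k (Function.update w i t) l = F t l :=
        fun t l hl => (if_pos hl).symm
      have hpair : Differentiable ℝ fun t => (s, F t) := (differentiable_const s).prodMk hF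
      have hμF : Differentiable ℝ fun t => μ j s (F t) :=
        ((hμC1 j).differentiable one_ne_zero).comp hpair
      have hηF : Differentiable ℝ fun t => η j s (F t) :=
        ((hηC1 j).differentiable one_ne_zero).comp hpair
      simp only [key, if_neg hj]
      simp only [fun t => hμdep j s _ _ (hFeq t), fun t => hηdep j s _ _ (hFeq t)]
      exact (hμF.const_mul _).add (hηF.const_mul _)

/-- The chain rule `∂ψ₀/∂θ_i = (∂ψ_i/∂z_i) (η_i - μ_i)`. -/
lemma gradTpsi0_eq (f : (Fin m → ℝ) → (Fin n → ℝ) → ℝ)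
    (μ η : Fin n → (Fin m → ℝ) → (Fin n → ℝ) → ℝ)
    (hfC1 : ContDiff ℝ 1 (fun p : (Fin m → ℝ) × (Fin n → ℝ) => f p.1 p.2))
    (hμC1 : ∀ i, ContDiff ℝ 1 (fun p : (Fin m → ℝ) × (Fin n → ℝ) => μ i p.1 p.2))
    (hηC1 : ∀ i, ContDiff ℝ 1 (fun p : (Fin m → ℝ) × (Fin n → ℝ) => η i p.1 p.2))
    (hμdep : ∀ (i : Fin n) (s : Fin m → ℝ) (z z' : Fin n → ℝ),
      (∀ j, j < i → z j = z' j) → μ i s z = μ i s z')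
    (hηdep : ∀ (i : Fin n) (s : Fin m → ℝ) (z z' : Fin n → ℝ),
      (∀ j, j < i → z j = z' j) → η i s z = η i s z')
    (s : Fin m → ℝ) (θ : Fin n → ℝ) (i : Fin n) :
    gradTpsi0 f μ η s θ i =
      psiD f μ η s θ i * (η i s (Fwd μ η s θ) - μ i s (Fwd μ η s θ)) := by
  set z := Fwd μ η s θ with hz
  let h : ℝ → ℝ := fun t => f s (fwdFrom μ η s θ (i + 1) (Function.update z i t))
  have hh : Differentiable ℝ h :=
    (hfC1.differentiable one_ne_zero).comp ((differentiable_const s).prodMk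
      (differentiable_fwdFrom_update μ η s θ z hμC1 hηC1 hμdep hηdep (i + 1) i))
  have ha : HasDerivAt (fun t : ℝ => (1 - t) * μ i s z + t * η i s z)
      (η i s z - μ i s z) (θ i) := by
    refine ((((hasDerivAt_id (θ i)).const_sub 1).mul_const (μ i s z)).add
      ((hasDerivAt_id (θ i)).mul_const (η i s z))).congr_deriv ?_
    ring
  have hzi : (1 - θ i) * μ i s z + θ i * η i s z = z i := by
    rw [hz, Fwd]
    conv_rhs => rw [fwdFrom_eq μ η hμdep hηdep, if_neg (Nat.not_lt_zero _)]
  have hcomp : HasDerivAt (h ∘ fun t : ℝ => (1 - t) * μ i s z + t * η i s z)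
      (deriv h (z i) * (η i s z - μ i s z)) (θ i) := by
    refine HasDerivAt.comp (θ i) ?_ ha
    rw [hzi]
    exact (hh (z i)).hasDerivAt
  have hfun : (fun t => psi0 f μ η s (Function.update θ i t)) =
      h ∘ fun t : ℝ => (1 - t) * μ i s z + t * η i s z := by
    funext t
    simp only [psi0, Function.comp, h, hz, Fwd_update μ η hμdep hηdep]
  rw [gradTpsi0, pd, hfun, hcomp.deriv]
  rfl

/-- The maximal gain `t` of `a d - (L/2) d²` over `d ∈ [0, x]`, where `x ≤ 1`,
controls `x a`. -/
lemma mul_le_max_sqrt_of_gain {L x a t : ℝ} (hL : 0 < L) (hx0 : 0 ≤ x) (hx1 : x ≤ 1)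
    (ha : 0 ≤ a) (ht : ∀ d, 0 ≤ d → d ≤ x → a * d - L / 2 * d ^ 2 ≤ t) :
    x * a ≤ max (Real.sqrt (2 * L * t)) (2 * t) := by
  rcases le_total a (L * x) with h | h
  · refine le_max_of_le_left ?_
    have h1 := ht (a / L) (by positivity) (by rwa [div_le_iff₀' hL])
    have h2 : a * (a / L) - L / 2 * (a / L) ^ 2 = a ^ 2 / (2 * L) := by
      field_simp
      ring
    rw [h2, div_le_iff₀ (by positivity)] at h1
    refine (mul_le_of_le_one_left ha hx1).trans (Real.le_sqrt_of_sq_le ?_)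
    linarith
  · refine le_max_of_le_right ?_
    nlinarith [ht x hx0 le_rfl, mul_le_mul_of_nonneg_left h hx0]

/-- Lemma 9 (per-coordinate bound on r_i via the coordinate gain). -/
theorem stmt11
    (m n : ℕ) (hm : 0 < m) (hn : 0 < n)
    (S : Set (Fin m → ℝ)) (hSne : S.Nonempty) (hSconv : Convex ℝ S)
    (hSbdd : Bornology.IsBounded S)
    (f : (Fin m → ℝ) → (Fin n → ℝ) → ℝ)
    (μ η : Fin n → (Fin m → ℝ) → (Fin n → ℝ) → ℝ)
    (hfC1 : ContDiff ℝ 1 (fun p : (Fin m → ℝ) × (Fin n → ℝ) => f p.1 p.2))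
    (hμC1 : ∀ i, ContDiff ℝ 1 (fun p : (Fin m → ℝ) × (Fin n → ℝ) => μ i p.1 p.2))
    (hηC1 : ∀ i, ContDiff ℝ 1 (fun p : (Fin m → ℝ) × (Fin n → ℝ) => η i p.1 p.2))
    (hfconv : ConvexOn ℝ (S ×ˢ (Set.univ : Set (Fin n → ℝ)))
      (fun p : (Fin m → ℝ) × (Fin n → ℝ) => f p.1 p.2))
    (hμconv : ∀ i, ConvexOn ℝ (S ×ˢ (Set.univ : Set (Fin n → ℝ)))
      (fun p : (Fin m → ℝ) × (Fin n → ℝ) => μ i p.1 p.2))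
    (hηconc : ∀ i, ConcaveOn ℝ (S ×ˢ (Set.univ : Set (Fin n → ℝ)))
      (fun p : (Fin m → ℝ) × (Fin n → ℝ) => η i p.1 p.2))
    (hμdep : ∀ (i : Fin n) (s : Fin m → ℝ) (z z' : Fin n → ℝ),
      (∀ j, j < i → z j = z' j) → μ i s z = μ i s z')
    (hηdep : ∀ (i : Fin n) (s : Fin m → ℝ) (z z' : Fin n → ℝ),
      (∀ j, j < i → z j = z' j) → η i s z = η i s z')
    (L : ℝ) (hL : 0 < L)
    (s : Fin m → ℝ) (θ : Fin n → ℝ) (hs : s ∈ S) (hθ : ∀ i, θ i ∈ Set.Icc (0:ℝ) 1)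
    (z y r : Fin n → ℝ) (hz : z = Fwd μ η s θ) (hy : ∀ i, y i = psiD f μ η s θ i)
    (hr : ∀ i, r i = θ i * max (y i) 0 + (1 - θ i) * max (-(y i)) 0)
    (i : Fin n) (hpos : 0 < η i s z - μ i s z)
    (tg : ℝ)
    (htg : tg = - sInf {v | ∃ d : ℝ, θ i + d ∈ Set.Icc (0:ℝ) 1 ∧
        v = gradTpsi0 f μ η s θ i * d + L / 2 * d ^ 2}) :
    r i ≤ max (Real.sqrt (2 * L * tg)) (2 * tg) / (η i s z - μ i s z) := by
  have hg := gradTpsi0_eq f μ η hfC1 hμC1 hηC1 hμdep hηdep s θ i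
  rw [← hy i, ← hz] at hg
  rw [le_div_iff₀ hpos, hr i]
  obtain ⟨hθ0, hθ1⟩ := hθ i
  set Δ := η i s z - μ i s z
  set g := gradTpsi0 f μ η s θ i
  have hgain : ∀ d, θ i + d ∈ Set.Icc (0 : ℝ) 1 → -(g * d + L / 2 * d ^ 2) ≤ tg := by
    intro d hd
    rw [htg]
    refine neg_le_neg (csInf_le ⟨-(g ^ 2 / (2 * L)), ?_⟩ ⟨d, hd, rfl⟩)
    rintro v ⟨e, -, rfl⟩
    have : g * e + L / 2 * e ^ 2 + g ^ 2 / (2 * L) = (L * e + g) ^ 2 / (2 * L) := by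
      field_simp
      ring
    have : 0 ≤ (L * e + g) ^ 2 / (2 * L) := by positivity
    linarith
  rcases le_total 0 (y i) with h | h
  · rw [max_eq_left h, max_eq_right (neg_nonpos.2 h), mul_zero, add_zero, mul_assoc, ← hg]
    refine mul_le_max_sqrt_of_gain hL hθ0 hθ1 (hg ▸ mul_nonneg h hpos.le) fun d hd0 hd => ?_
    have := hgain (-d) ⟨by linarith, by linarith⟩
    linarith
  · rw [max_eq_right h, max_eq_left (neg_nonneg.2 h), mul_zero, zero_add, mul_assoc, neg_mul, ← hg]
    refine mul_le_max_sqrt_of_gain hL (sub_nonneg.2 hθ1) (by linarith)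
      (neg_nonneg.2 (hg ▸ mul_nonpos_of_nonpos_of_nonneg h hpos.le)) fun d hd0 hd => ?_
    have := hgain d ⟨by linarith, by linarith⟩
    linarith

end
end

section
/- Let n be a positive integer, a ∈ ℝ^n, b ∈ ℝ^{n+1}, and suppose a satisfies the backward recursion a_i = b_{n+1} + Σ_{j=i+1}^n a_j b_j for every i ∈ {1,…,n}. Then ‖a‖_1 ≤ (1 + ‖b‖_∞)^n, where ‖a‖_1 = Σ_i |a_i| and ‖b‖_∞ = max_i |b_i|. -/
open Finset

/-- A discrete backward Grönwall inequality. -/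
theorem one_add_sum_le_pow_of_le_mul_sum_Ioi {M : ℝ} (hM : 0 ≤ M) (n : ℕ) (x : Fin n → ℝ)
    (hx : ∀ i, x i ≤ M * (1 + ∑ j ∈ Finset.Ioi i, x j)) :
    1 + ∑ i, x i ≤ (1 + M) ^ n := by
  induction n with
  | zero => simp
  | succ n ih =>
    have tail := ih (fun i => x i.succ) fun i => by
      simpa [← Fin.map_succEmb_Ioi] using hx i.succ
    have head : x 0 ≤ M * (1 + ∑ i : Fin n, x i.succ) := by
      simpa [Fin.Ioi_zero_eq_map] using hx 0
    rw [Fin.sum_univ_succ, pow_succ]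
    nlinarith [mul_le_mul_of_nonneg_left tail hM]

/-- Fact 4: if `a` satisfies the backward recursion `a_i = b_{n+1} + Σ_{j>i} a_j b_j`,
then `‖a‖₁ ≤ (1 + ‖b‖_∞)^n`.  Here `‖a‖₁ = Σ |a_i|` and `‖b‖` is the sup norm on
`Fin (n+1) → ℝ`, i.e. `max_i |b_i|`. -/
theorem stmt14 (n : ℕ) (hn : 0 < n) (a : Fin n → ℝ) (b : Fin (n + 1) → ℝ)
    (hrec : ∀ i : Fin n, a i = b (Fin.last n) + ∑ j ∈ Finset.Ioi i, a j * b j.castSucc) :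
    (∑ i, |a i|) ≤ (1 + ‖b‖) ^ n := by
  have hb (k : Fin (n + 1)) : |b k| ≤ ‖b‖ := norm_le_pi_norm b k
  have h := one_add_sum_le_pow_of_le_mul_sum_Ioi (norm_nonneg b) n (fun i => |a i|) fun i => by
    calc |a i| = |b (Fin.last n) + ∑ j ∈ Finset.Ioi i, a j * b j.castSucc| := by rw [← hrec i]
      _ ≤ |b (Fin.last n)| + ∑ j ∈ Finset.Ioi i, |a j * b j.castSucc| :=
        (abs_add_le _ _).trans (by gcongr; exact Finset.abs_sum_le_sum_abs _ _)
      _ ≤ ‖b‖ + ∑ j ∈ Finset.Ioi i, ‖b‖ * |a j| := by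
        gcongr with j
        · exact hb _
        · rw [abs_mul, mul_comm]
          exact mul_le_mul_of_nonneg_right (hb _) (abs_nonneg _)
      _ = ‖b‖ * (1 + ∑ j ∈ Finset.Ioi i, |a j|) := by rw [← Finset.mul_sum]; ring
  linarith
end
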